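/- The q-series S(q) := Σ_{n≥0} (q;q²)_n² q^{2n} / (−q²;q²)_n satisfies S(q) = 2B(−q) − ((q;q²)_∞² / (−q²;q²)_∞) · ω(−q), where B and ω are the given mock theta functions. -/

import Mathlib

open scoped BigOperators

/-- Infinite q-Pochhammer symbol `(a; q)_∞`. -/
noncomputable def pochInf (a q : ℂ) : ℂ := ∏' j : ℕ, (1 - a * q ^ j)

/-- Finite q-Pochhammer symbol `(a; q)_n`. -/
noncomputable def pochN (a q : ℂ) (n : ℕ) : ℂ := ∏ j ∈ Finset.range n, (1 - a * q ^ j)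

/-- `S(q) = Σ_{n ≥ 0} (q; q²)_n² q^{2n} / (−q²; q²)_n`. -/
noncomputable def Sq (q : ℂ) : ℂ :=
  ∑' n : ℕ, pochN q (q ^ 2) n ^ 2 * q ^ (2 * n) / pochN (-q ^ 2) (q ^ 2) n

/-- Ramanujan's third order mock theta function
`ω(q) = Σ_{n ≥ 0} q^{2n(n+1)} / (q; q²)_{n+1}²`. -/
noncomputable def omegaMock (q : ℂ) : ℂ :=
  ∑' n : ℕ, q ^ (2 * n * (n + 1)) / pochN q (q ^ 2) (n + 1) ^ 2

/-- McIntosh's second order mock theta function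
`B(q) = Σ_{n ≥ 0} (−q²; q²)_n q^{n(n+1)} / (q; q²)_{n+1}²`. -/
noncomputable def Bmock (q : ℂ) : ℂ :=
  ∑' n : ℕ, pochN (-q ^ 2) (q ^ 2) n * q ^ (n * (n + 1)) / pochN q (q ^ 2) (n + 1) ^ 2

open Filter Topology Finset

lemma exists_norm_le_of_tendsto {u : ℕ → ℂ} {l : ℂ} (h : Tendsto u atTop (𝓝 l)) :
    ∃ C, 0 ≤ C ∧ ∀ n, ‖u n‖ ≤ C := by
  obtain ⟨C, hC⟩ := isBounded_iff_forall_norm_le.1 (Metric.isBounded_range_of_tendsto u h)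
  exact ⟨C, (norm_nonneg _).trans (hC _ ⟨0, rfl⟩), fun n => hC _ ⟨n, rfl⟩⟩

lemma pochN_succ (a Q : ℂ) (n : ℕ) : pochN a Q (n + 1) = pochN a Q n * (1 - a * Q ^ n) :=
  prod_range_succ _ _

lemma pochN_zero_left (Q : ℂ) (n : ℕ) : pochN 0 Q n = 1 := by simp [pochN]

lemma pochN_ne_zero {a Q : ℂ} (h : ∀ j, 1 - a * Q ^ j ≠ 0) (n : ℕ) : pochN a Q n ≠ 0 :=
  prod_ne_zero_iff.2 fun j _ => h j

lemma one_sub_mul_pow_ne_zero {a Q : ℂ} (ha : ‖a‖ < 1) (hQ : ‖Q‖ < 1) (j : ℕ) :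
    1 - a * Q ^ j ≠ 0 := by
  intro h
  have h1 : ‖a * Q ^ j‖ = 1 := by rw [← sub_eq_zero.1 h, norm_one]
  rw [norm_mul, norm_pow] at h1
  have h2 : ‖Q‖ ^ j ≤ 1 := pow_le_one₀ (norm_nonneg _) hQ.le
  nlinarith [norm_nonneg a, norm_nonneg Q]

lemma summable_norm_neg_mul_pow (a : ℂ) {Q : ℂ} (hQ : ‖Q‖ < 1) :
    Summable fun j : ℕ => ‖-(a * Q ^ j)‖ := by
  simpa using (summable_geometric_of_lt_one (norm_nonneg Q) hQ).mul_left ‖a‖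

lemma tendsto_pochN (a : ℂ) {Q : ℂ} (hQ : ‖Q‖ < 1) :
    Tendsto (pochN a Q) atTop (𝓝 (pochInf a Q)) := by
  have h := (multipliable_one_add_of_summable
    (summable_norm_neg_mul_pow a hQ)).tendsto_prod_tprod_nat
  simp only [← sub_eq_add_neg] at h
  exact h

lemma pochInf_ne_zero {a Q : ℂ} (hQ : ‖Q‖ < 1) (h : ∀ j, 1 - a * Q ^ j ≠ 0) :
    pochInf a Q ≠ 0 := by
  have h := tprod_one_add_ne_zero_of_summable (f := fun j : ℕ => -(a * Q ^ j))
    (by simpa only [← sub_eq_add_neg] using h) (summable_norm_neg_mul_pow a hQ)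
  simp only [← sub_eq_add_neg] at h
  exact h

lemma exists_norm_pochN_le (a : ℂ) {Q : ℂ} (hQ : ‖Q‖ < 1) :
    ∃ C, 0 ≤ C ∧ ∀ n, ‖pochN a Q n‖ ≤ C :=
  exists_norm_le_of_tendsto (tendsto_pochN a hQ)

lemma exists_norm_inv_pochN_le {a Q : ℂ} (hQ : ‖Q‖ < 1) (h : ∀ j, 1 - a * Q ^ j ≠ 0) :
    ∃ C, 0 ≤ C ∧ ∀ n, ‖(pochN a Q n)⁻¹‖ ≤ C :=
  exists_norm_le_of_tendsto ((tendsto_pochN a hQ).inv₀ (pochInf_ne_zero hQ h))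

lemma tendsto_mul_pow_zero (a : ℂ) {Q : ℂ} (hQ : ‖Q‖ < 1) :
    Tendsto (fun n : ℕ => a * Q ^ n) atTop (𝓝 0) := by
  simpa using (tendsto_pow_atTop_nhds_zero_of_norm_lt_one hQ).const_mul a

lemma tendsto_one_sub_mul_pow (a : ℂ) {Q : ℂ} (hQ : ‖Q‖ < 1) :
    Tendsto (fun n : ℕ => 1 - a * Q ^ n) atTop (𝓝 1) := by
  simpa using (tendsto_mul_pow_zero a hQ).const_sub 1

lemma summable_prod_of_tendsto {r : ℕ → ℂ} {l : ℂ} (hr : Tendsto r atTop (𝓝 l)) (hl : ‖l‖ < 1) :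
    Summable fun n => ∏ j ∈ range n, r j := by
  obtain ⟨ρ, h1, h2⟩ := exists_between hl
  refine summable_of_ratio_norm_eventually_le h2 ?_
  filter_upwards [hr.norm.eventually_le_const h1] with n hn
  rw [prod_range_succ, norm_mul, mul_comm]
  gcongr

/-- A bounded solution of the recurrence `x k = A k + r k * x (k + 1)` is given by iterating it. -/
lemma hasSum_of_recurrence {x A r : ℕ → ℂ} {l : ℂ} {C D : ℝ}
    (h : ∀ k, x k = A k + r k * x (k + 1)) (hr : Tendsto r atTop (𝓝 l)) (hl : ‖l‖ < 1)
    (hA : ∀ k, ‖A k‖ ≤ C) (hx : ∀ k, ‖x k‖ ≤ D) :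
    HasSum (fun k => A k * ∏ j ∈ range k, r j) (x 0) := by
  have hs := summable_prod_of_tendsto hr hl
  have hsum : Summable fun k => A k * ∏ j ∈ range k, r j := by
    refine Summable.of_norm_bounded (hs.norm.mul_left C) fun k => ?_
    rw [norm_mul]
    exact mul_le_mul_of_nonneg_right (hA k) (norm_nonneg _)
  have hpart : ∀ N, ∑ k ∈ range N, A k * ∏ j ∈ range k, r j
      = x 0 - x N * ∏ j ∈ range N, r j := by
    intro N
    induction N with
    | zero => simp
    | succ N ih =>
      rw [sum_range_succ, ih, prod_range_succ, h N]
      ring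
  have hzero : Tendsto (fun N => x N * ∏ j ∈ range N, r j) atTop (𝓝 0) :=
    isBoundedUnder_le_mul_tendsto_zero (isBoundedUnder_of ⟨D, hx⟩) hs.tendsto_atTop_zero
  have hlim : Tendsto (fun N => ∑ k ∈ range N, A k * ∏ j ∈ range k, r j) atTop (𝓝 (x 0)) := by
    simp_rw [hpart]
    simpa using hzero.const_sub (x 0)
  rw [← tendsto_nhds_unique hsum.hasSum.tendsto_sum_nat hlim]
  exact hsum.hasSum

lemma summable_and_norm_tsum_le {f : ℕ → ℂ} {C s : ℝ} (hs0 : 0 ≤ s) (hs : s < 1)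
    (h : ∀ n, ‖f n‖ ≤ C * s ^ n) : Summable f ∧ ‖∑' n, f n‖ ≤ C * (1 - s)⁻¹ :=
  ⟨.of_norm_bounded ((summable_geometric_of_lt_one hs0 hs).mul_left C) h,
    tsum_of_norm_bounded ((hasSum_geometric_of_lt_one hs0 hs).mul_left C) h⟩

lemma exists_norm_pow_mul_pochN_div_le (a : ℂ) {b t Q : ℂ} (hQ : ‖Q‖ < 1)
    (hb : ∀ j, 1 - b * Q ^ j ≠ 0) :
    ∃ C, ∀ N m, ‖(t * Q ^ N) ^ m * pochN a Q m / pochN b Q (N + m + 1)‖ ≤ C * ‖t‖ ^ m := by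
  obtain ⟨C, hC0, hC⟩ := exists_norm_pochN_le a hQ
  obtain ⟨D, hD0, hD⟩ := exists_norm_inv_pochN_le hQ hb
  refine ⟨C * D, fun N m => ?_⟩
  have h1 : ‖t * Q ^ N‖ ≤ ‖t‖ := by
    rw [norm_mul, norm_pow]
    exact mul_le_of_le_one_right (norm_nonneg _) (pow_le_one₀ (norm_nonneg _) hQ.le)
  rw [div_eq_mul_inv, norm_mul, norm_mul, norm_pow]
  calc _ ≤ ‖t‖ ^ m * C * D := by
        gcongr
        · exact hC m
        · exact hD _
    _ = _ := by ring

lemma summable_pow_mul_pochN_div (a : ℂ) {b t Q : ℂ} (hQ : ‖Q‖ < 1) (ht : ‖t‖ < 1)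
    (hb : ∀ j, 1 - b * Q ^ j ≠ 0) :
    Summable fun m => t ^ m * pochN a Q m / pochN b Q (m + 1) := by
  obtain ⟨C, hC⟩ := exists_norm_pow_mul_pochN_div_le a hQ hb
  simpa using (summable_and_norm_tsum_le (norm_nonneg t) ht (hC 0)).1

/-- A Fine-type transformation of `∑ (a; Q)_m t ^ m / (b; Q)_{m + 1}`. -/
lemma tsum_pow_mul_pochN_div (a : ℂ) {b t Q : ℂ} (hQ : ‖Q‖ < 1) (ht : ‖t‖ < 1)
    (hb : ∀ j, 1 - b * Q ^ j ≠ 0) :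
    ∑' m, t ^ m * pochN a Q m / pochN b Q (m + 1) =
      ∑' n, (∏ j ∈ range n, t * Q ^ j * (b * Q ^ (j + 1) - a)) /
        (pochN b Q (n + 1) * pochN t Q (n + 1)) := by
  obtain ⟨C, hC⟩ := exists_norm_pow_mul_pochN_div_le a hQ hb
  have hsum N := summable_and_norm_tsum_le (norm_nonneg t) ht (hC N)
  have htne := one_sub_mul_pow_ne_zero ht hQ
  have hbne := pochN_ne_zero hb
  obtain ⟨D, hD0, hD⟩ := exists_norm_inv_pochN_le hQ hb
  obtain ⟨E, -, hE⟩ := exists_norm_le_of_tendsto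
    ((tendsto_one_sub_mul_pow t hQ).inv₀ one_ne_zero)
  have key := hasSum_of_recurrence (l := 0) (C := D * E)
    (x := fun N => ∑' m, (t * Q ^ N) ^ m * pochN a Q m / pochN b Q (N + m + 1))
    (A := fun N => (pochN b Q (N + 1))⁻¹ * (1 - t * Q ^ N)⁻¹)
    (r := fun N => t * Q ^ N * (b * Q ^ (N + 1) - a) * (1 - t * Q ^ N)⁻¹)
    (fun N => ?_) ?_ (by simp) (fun N => ?_) (fun N => (hsum N).2)
  · simp only [pow_zero, mul_one, zero_add] at key
    rw [← key.tsum_eq]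
    refine tsum_congr fun n => ?_
    rw [prod_mul_distrib, prod_inv_distrib]
    change (pochN b Q (n + 1))⁻¹ * (1 - t * Q ^ n)⁻¹ * (_ * (pochN t Q n)⁻¹) = _
    rw [pochN_succ t, div_eq_mul_inv, mul_inv, mul_inv]
    ring
  · have h1 : (1 - t * Q ^ N) * ∑' m, (t * Q ^ N) ^ m * pochN a Q m / pochN b Q (N + m + 1) =
        (pochN b Q (N + 1))⁻¹ + t * Q ^ N * (b * Q ^ (N + 1) - a) *
          ∑' m, (t * Q ^ (N + 1)) ^ m * pochN a Q m / pochN b Q (N + 1 + m + 1) := by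
      have h2 := (hsum N).1.tsum_eq_zero_add
      have h3 : ∑' m, (t * Q ^ N) ^ (m + 1) * pochN a Q (m + 1) / pochN b Q (N + (m + 1) + 1) =
          t * Q ^ N * (∑' m, (t * Q ^ N) ^ m * pochN a Q m / pochN b Q (N + m + 1)) +
          t * Q ^ N * (b * Q ^ (N + 1) - a) *
          ∑' m, (t * Q ^ (N + 1)) ^ m * pochN a Q m / pochN b Q (N + 1 + m + 1) := by
        rw [← tsum_mul_left, ← tsum_mul_left,
          ← ((hsum N).1.mul_left _).tsum_add ((hsum (N + 1)).1.mul_left _)]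
        refine tsum_congr fun m => ?_
        have e1 : N + (m + 1) + 1 = N + m + 1 + 1 := by ring
        have e2 : N + 1 + m + 1 = N + m + 1 + 1 := by ring
        have hne := hbne (N + m + 1)
        have hne' := hb (N + m + 1)
        rw [e1, e2, pochN_succ b, pochN_succ a, mul_pow _ (Q ^ (N + 1)), mul_pow _ (Q ^ N),
          mul_pow _ (Q ^ N)]
        field_simp
        ring
      have h4 : pochN a Q 0 = 1 := by simp [pochN]
      rw [h3] at h2
      simp only [pow_zero, h4, add_zero, one_mul, one_div] at h2
      linear_combination h2
    have h5 := htne N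
    rw [← eq_inv_mul_iff_mul_eq₀ h5] at h1
    rw [h1]
    ring
  · have h1 : Tendsto (fun N : ℕ => b * Q ^ (N + 1) - a) atTop (𝓝 (0 - a)) :=
      ((tendsto_mul_pow_zero b hQ).comp (tendsto_add_atTop_nat 1)).sub_const a
    simpa using ((tendsto_mul_pow_zero t hQ).mul h1).mul
      ((tendsto_one_sub_mul_pow t hQ).inv₀ one_ne_zero)
  · rw [norm_mul]
    exact mul_le_mul (hD _) (hE _) (norm_nonneg _) hD0

/-- The three-term relation for `∑ (a; Q)_n (b; Q)_n Q ^ n / (-Q; Q)_n`. -/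
lemma tsum_pochN_mul_pochN_div {a b Q : ℂ} (hQ : ‖Q‖ < 1) (hb : ‖b‖ < 1)
    (ha : ∀ j, 1 - -a * Q ^ j ≠ 0) :
    ∑' n, pochN a Q n * pochN b Q n * Q ^ n / pochN (-Q) Q n =
      2 * ∑' k, (-b) ^ k * pochN a Q k / pochN (-a) Q (k + 1) -
        pochInf a Q * pochInf b Q / pochInf (-Q) Q * ∑' k, (-b) ^ k / pochN (-a) Q (k + 1) := by
  have hγ := one_sub_mul_pow_ne_zero (a := -Q) (by rwa [norm_neg]) hQ
  have hγne := pochN_ne_zero hγ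
  have hb' : ‖-b‖ < 1 := by rwa [norm_neg]
  obtain ⟨A, hA0, hA⟩ := exists_norm_pochN_le a hQ
  obtain ⟨B, hB0, hB⟩ := exists_norm_pochN_le b hQ
  obtain ⟨D, hD0, hD⟩ := exists_norm_inv_pochN_le hQ hγ
  obtain ⟨E, -, hE⟩ := exists_norm_le_of_tendsto
    ((tendsto_one_sub_mul_pow (-a) hQ).inv₀ one_ne_zero)
  set P := pochInf a Q * pochInf b Q / pochInf (-Q) Q
  have hsum k := summable_and_norm_tsum_le (C := A * B * D) (norm_nonneg Q) hQ
    (f := fun n => pochN a Q (n + k) * pochN b Q n * Q ^ n / pochN (-Q) Q n) fun n => by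
      rw [div_eq_mul_inv, norm_mul, norm_mul, norm_mul, norm_pow]
      calc _ ≤ A * B * ‖Q‖ ^ n * D := by
            gcongr
            exacts [hA _, hB _, hD _]
        _ = _ := by ring
  have key := hasSum_of_recurrence (l := -b) (C := (2 * A + ‖P‖) * E)
    (x := fun k => ∑' n, pochN a Q (n + k) * pochN b Q n * Q ^ n / pochN (-Q) Q n)
    (A := fun k => (2 * pochN a Q k - P) * (1 - -a * Q ^ k)⁻¹)
    (r := fun k => -b * (1 - -a * Q ^ k)⁻¹)
    (fun k => ?_) ?_ hb' (fun k => ?_) (fun k => (hsum k).2)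
  · have h1 := summable_pow_mul_pochN_div a hQ hb' ha
    have h2 := summable_pow_mul_pochN_div 0 hQ hb' ha
    simp only [pochN_zero_left, mul_one] at h2
    simp only [add_zero] at key
    rw [← key.tsum_eq, ← tsum_mul_left, ← tsum_mul_left,
      ← (h1.mul_left 2).tsum_sub (Summable.mul_left P h2)]
    refine tsum_congr fun k => ?_
    rw [prod_mul_distrib, prod_inv_distrib, prod_const, card_range]
    change _ * (1 - -a * Q ^ k)⁻¹ * (_ * (pochN (-a) Q k)⁻¹) = _
    rw [pochN_succ (-a), div_eq_mul_inv, div_eq_mul_inv, mul_inv]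
    ring
  · set v : ℕ → ℂ := fun n =>
      pochN a Q (n + k) * pochN b Q n * (1 - -1 * Q ^ n) / pochN (-Q) Q n with hv
    have hlim : Tendsto v atTop (𝓝 P) := by
      have := ((((tendsto_pochN a hQ).comp (tendsto_add_atTop_nat k)).mul
        (tendsto_pochN b hQ)).mul (tendsto_one_sub_mul_pow (-1) hQ)).div (tendsto_pochN (-Q) hQ)
        (pochInf_ne_zero hQ hγ)
      rwa [mul_one] at this
    have hsk := ((hsum k).1.mul_left (1 - -a * Q ^ k)).add ((hsum (k + 1)).1.mul_left b)
    have hstep : ∀ n, (1 - -a * Q ^ k) *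
        (pochN a Q (n + k) * pochN b Q n * Q ^ n / pochN (-Q) Q n) +
        b * (pochN a Q (n + (k + 1)) * pochN b Q n * Q ^ n / pochN (-Q) Q n) =
        v n - v (n + 1) := by
      intro n
      have e1 : n + 1 + k = n + k + 1 := by ring
      have h1 := hγne n
      have h2 := hγ n
      have h3 : 1 - -1 * Q ^ (n + 1) = 1 - -Q * Q ^ n := by ring
      simp only [hv, e1, ← add_assoc, pochN_succ, h3]
      rw [mul_div_mul_right _ _ h2]
      field_simp
      ring
    have htel : Tendsto (fun N => ∑ n ∈ range N, (v n - v (n + 1))) atTop (𝓝 (v 0 - P)) := by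
      simp_rw [sum_range_sub']
      exact hlim.const_sub _
    have hv0 : v 0 = 2 * pochN a Q k := by
      simp [hv, pochN]
      ring
    have h1 := tendsto_nhds_unique (hsk.hasSum.tendsto_sum_nat.congr fun N =>
      sum_congr rfl fun n _ => hstep n) htel
    rw [((hsum k).1.mul_left _).tsum_add ((hsum (k + 1)).1.mul_left _), tsum_mul_left,
      tsum_mul_left, hv0] at h1
    have h5 := ha k
    rw [← eq_sub_iff_add_eq, ← eq_inv_mul_iff_mul_eq₀ h5] at h1
    rw [h1]
    ring
  · simpa using ((tendsto_one_sub_mul_pow (-a) hQ).inv₀ one_ne_zero).const_mul (-b)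
  · rw [norm_mul]
    refine mul_le_mul ((norm_sub_le _ _).trans ?_) (hE _) (norm_nonneg _) (by positivity)
    rw [norm_mul, Complex.norm_ofNat]
    gcongr
    exact hA k

lemma prod_neg_mul_pow_mul_sub_eq (q : ℂ) (n : ℕ) :
    ∏ j ∈ range n, -q * (q ^ 2) ^ j * (-q * (q ^ 2) ^ (j + 1) - q) =
      pochN (-q ^ 2) (q ^ 2) n * q ^ (n * (n + 1)) := by
  induction n with
  | zero => simp [pochN]
  | succ n ih =>
    rw [prod_range_succ, ih, pochN_succ]
    ring

lemma prod_neg_mul_pow_mul_sub_zero_eq (q : ℂ) (n : ℕ) :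
    ∏ j ∈ range n, -q * (q ^ 2) ^ j * (-q * (q ^ 2) ^ (j + 1) - 0) = q ^ (2 * n * (n + 1)) := by
  induction n with
  | zero => simp
  | succ n ih =>
    rw [prod_range_succ, ih]
    ring

/-- `S(q) = 2B(−q) − ((q;q²)_∞² / (−q²;q²)_∞) ω(−q)`. -/
theorem stmt1 (q : ℂ) (hq : ‖q‖ < 1) :
    Sq q = 2 * Bmock (-q) -
      pochInf q (q ^ 2) ^ 2 / pochInf (-q ^ 2) (q ^ 2) * omegaMock (-q) := by
  have hQ : ‖q ^ 2‖ < 1 := by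
    rw [norm_pow]
    exact pow_lt_one₀ (norm_nonneg _) hq two_ne_zero
  have hq' : ‖-q‖ < 1 := by rwa [norm_neg]
  have hne := one_sub_mul_pow_ne_zero hq' hQ
  have hS := tsum_pochN_mul_pochN_div hQ hq hne
  have hB := tsum_pow_mul_pochN_div q hQ hq' hne
  have hω := tsum_pow_mul_pochN_div 0 hQ hq' hne
  simp only [prod_neg_mul_pow_mul_sub_eq] at hB
  simp only [prod_neg_mul_pow_mul_sub_zero_eq] at hω
  simp only [pochN_zero_left, mul_one] at hω
  rw [hB, hω] at hS
  have e1 : ∀ n, (-q) ^ (n * (n + 1)) = q ^ (n * (n + 1)) := fun n =>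
    (Nat.even_mul_succ_self n).neg_pow q
  have e2 : ∀ n, (-q) ^ (2 * n * (n + 1)) = q ^ (2 * n * (n + 1)) := fun n =>
    Even.neg_pow ⟨n * (n + 1), by ring⟩ q
  simp only [Sq, Bmock, omegaMock, neg_sq, e1, e2, pow_mul q 2, pow_two (pochN _ _ _),
    pow_two (pochInf _ _)] at hS ⊢
  exact hS
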